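/- Let I₁, I₂ ⊆ ℝ be open intervals, let f₂ : I₁ → ℝ and f₃ : I₁ × I₂ → ℝ be smooth nowhere-zero functions, and define a₂₁ := f₂'/f₂ on I₁, a₃₁ := (∂₁f₃)/f₃ and a₃₂ := f₂·(∂₂f₃)/f₃ on I₁ × I₂. Then the system { a₂₁' = a₂₁² on I₁; ∂₁a₃₁ = a₃₁², f₂·∂₂a₃₂ − a₃₂² = a₂₁a₃₁, and ∂₁a₃₂ = a₃₁a₃₂ on I₁ × I₂ } holds if and only if one of the following holds: (1) f₂ = k₂ and f₃ = k₃ are constants, k₂, k₃ ∈ ℝ \ {0}; (2) f₂ = k₂ is constant and f₃(x¹,x²) = k₃/(x¹ − c₃) with k₃ ∈ ℝ \ {0}, c₃ ∈ ℝ \ I₁; (3) f₂ = k₂ is constant and f₃(x¹,x²) = k₃/(x² − c₃) with k₃ ∈ ℝ \ {0}, c₃ ∈ ℝ \ I₂; (4) f₂ = k₂ is constant and f₃(x¹,x²) = k₃/(c₁x¹ + x² + c₂) with k₃, c₁ ∈ ℝ \ {0}, c₂ ∈ ℝ, and c₁x¹ + x² + c₂ ≠ 0 on I₁ × I₂; (5)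 f₂(x¹) = k₂/(x¹ − c₂) with k₂ ∈ ℝ \ {0}, c₂ ∈ ℝ \ I₁, and f₃ = k₃ ∈ ℝ \ {0} is constant; (6) f₂(x¹) = k₂/(x¹ − c₂) and f₃(x¹,x²) = k₃/[(x¹ − c₂)·cos(x²/k₂ − c₃)] with k₂, k₃ ∈ ℝ \ {0}, c₂ ∈ ℝ \ I₁, c₃ ∈ ℝ and |x²/k₂ − c₃| < π/2 for all x² ∈ I₂; (7) f₂(x¹) = k₂/(x¹ − c₂) and f₃(x¹,x²) = k₃/[1 + c₁(x¹ − c₂)·cos(x²/k₂ − c₃)] with c₁, k₂, k₃ ∈ ℝ \ {0}, c₂ ∈ ℝ \ I₁, c₃ ∈ ℝ, and 1 + c₁(x¹ − c₂)cos(x²/k₂ − c₃) ≠ 0 for all (x¹, x²) ∈ I₁ × I₂. -/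

import Mathlib

open Set Filter Topology

theorem exists_eq_const_of_hasDerivAt_zero {I : Set ℝ} (hI : IsOpen I) (hc : I.OrdConnected)
    {f : ℝ → ℝ} (hf : ∀ x ∈ I, HasDerivAt f 0 x) : ∃ a, ∀ x ∈ I, f x = a :=
  hI.exists_is_const_of_deriv_eq_zero hc.isPreconnected
    (fun x hx => (hf x hx).differentiableAt.differentiableWithinAt)
    (fun x hx => (hf x hx).deriv)

theorem exists_eq_affine_of_hasDerivAt_const {I : Set ℝ} (hI : IsOpen I) (hc : I.OrdConnected)
    {f : ℝ → ℝ} {a : ℝ} (hf : ∀ x ∈ I, HasDerivAt f a x) : ∃ b, ∀ x ∈ I, f x = a * x + b := by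
  obtain ⟨b, hb⟩ := exists_eq_const_of_hasDerivAt_zero hI hc (f := fun x => f x - a * x)
    (fun x hx => by simpa using (hf x hx).fun_sub ((hasDerivAt_id x).const_mul a))
  exact ⟨b, fun x hx => by linarith [hb x hx]⟩

theorem ContDiffOn.hasDerivAt_of_isOpen {I : Set ℝ} (hI : IsOpen I) {f : ℝ → ℝ}
    (hf : ContDiffOn ℝ (⊤ : ℕ∞) f I) {x : ℝ} (hx : x ∈ I) : HasDerivAt f (deriv f x) x :=
  ((hf.contDiffAt (hI.mem_nhds hx)).differentiableAt (by simp)).hasDerivAt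

theorem ContDiffOn.deriv_of_isOpen_top {I : Set ℝ} (hI : IsOpen I) {f : ℝ → ℝ}
    (hf : ContDiffOn ℝ (⊤ : ℕ∞) f I) : ContDiffOn ℝ (⊤ : ℕ∞) (deriv f) I :=
  hf.deriv_of_isOpen hI (by simp)

/-- If the logarithmic derivative `a` of `f` satisfies `a' = a²`, then `1/f` is affine. -/
theorem exists_inv_eq_affine {I : Set ℝ} (hI : IsOpen I) (hc : I.OrdConnected)
    {f : ℝ → ℝ} (hf : ContDiffOn ℝ (⊤ : ℕ∞) f I) (hne : ∀ x ∈ I, f x ≠ 0)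
    (h : ∀ x ∈ I, deriv (fun t => deriv f t / f t) x = (deriv f x / f x) ^ 2) :
    ∃ a b : ℝ, ∀ x ∈ I, (f x)⁻¹ = a * x + b := by
  have h1 : ∀ x ∈ I, HasDerivAt f (deriv f x) x := fun x hx => hf.hasDerivAt_of_isOpen hI hx
  have h2 : ∀ x ∈ I, HasDerivAt (deriv f) (deriv (deriv f) x) x := fun x hx =>
    (hf.deriv_of_isOpen_top hI).hasDerivAt_of_isOpen hI hx
  have h3 : ∀ x ∈ I, HasDerivAt (fun x => (f x)⁻¹) (-deriv f x / f x ^ 2) x :=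
    fun x hx => (h1 x hx).fun_inv (hne x hx)
  obtain ⟨a, ha⟩ := exists_eq_const_of_hasDerivAt_zero hI hc
    (f := fun x => -deriv f x / f x ^ 2) (fun x hx => by
      have hx0 := hne x hx
      have e := h x hx
      rw [((h2 x hx).fun_div (h1 x hx) hx0).deriv] at e
      refine ((h2 x hx).fun_neg.fun_div ((h1 x hx).fun_pow 2) (pow_ne_zero 2 hx0)).congr_deriv ?_
      field_simp at e ⊢
      push_cast
      linear_combination (-f x) * e)
  obtain ⟨b, hb⟩ := exists_eq_affine_of_hasDerivAt_const hI hc (f := fun x => (f x)⁻¹) (a := a)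
    (fun x hx => by rw [← ha x hx]; exact h3 x hx)
  exact ⟨a, b, hb⟩

/-- Solutions of the harmonic oscillator equation in amplitude-phase form. -/
theorem exists_eq_mul_cos_of_oscillator {I : Set ℝ} (hI : IsOpen I) (hc : I.OrdConnected)
    {A A' : ℝ → ℝ} {q : ℝ} (hq : q ≠ 0) (hA : ∀ y ∈ I, HasDerivAt A (A' y) y)
    (hA' : ∀ y ∈ I, HasDerivAt A' (-q ^ 2 * A y) y) :
    ∃ R c : ℝ, ∀ y ∈ I, A y = R * Real.cos (q * y - c) := by
  have hcos : ∀ y : ℝ, HasDerivAt (fun y => Real.cos (q * y)) (-Real.sin (q * y) * q) y :=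
    fun y => by simpa using ((hasDerivAt_id y).const_mul q).cos
  have hsin : ∀ y : ℝ, HasDerivAt (fun y => Real.sin (q * y)) (Real.cos (q * y) * q) y :=
    fun y => by simpa using ((hasDerivAt_id y).const_mul q).sin
  obtain ⟨P, hP⟩ := exists_eq_const_of_hasDerivAt_zero hI hc
    (f := fun y => A y * Real.cos (q * y) - A' y / q * Real.sin (q * y)) (fun y hy => by
      refine (((hA y hy).fun_mul (hcos y)).fun_sub
        (((hA' y hy).div_const q).fun_mul (hsin y))).congr_deriv ?_
      field_simp
      ring)
  obtain ⟨Q, hQ⟩ := exists_eq_const_of_hasDerivAt_zero hI hc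
    (f := fun y => A y * Real.sin (q * y) + A' y / q * Real.cos (q * y)) (fun y hy => by
      refine (((hA y hy).fun_mul (hsin y)).fun_add
        (((hA' y hy).div_const q).fun_mul (hcos y))).congr_deriv ?_
      field_simp
      ring)
  refine ⟨‖(⟨P, Q⟩ : ℂ)‖, Complex.arg ⟨P, Q⟩, fun y hy => ?_⟩
  have e1 := Complex.norm_mul_cos_arg ⟨P, Q⟩
  have e2 := Complex.norm_mul_sin_arg ⟨P, Q⟩
  simp only at e1 e2
  rw [Real.cos_sub]
  linear_combination (-A y) * Real.sin_sq_add_cos_sq (q * y) - Real.cos (q * y) * e1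
    - Real.sin (q * y) * e2 + Real.cos (q * y) * hP y hy + Real.sin (q * y) * hQ y hy

/-- If `cos (q y - c)` has no zero on an interval, the phase can be shifted by a multiple of `π`
so that `q y - c` stays in `(-π/2, π/2)`. -/
theorem exists_phase_abs_lt {I : Set ℝ} (hc : I.OrdConnected) (hne : I.Nonempty) {q c : ℝ}
    (h : ∀ y ∈ I, Real.cos (q * y - c) ≠ 0) :
    ∃ c' ε : ℝ, ε ≠ 0 ∧ (∀ y, Real.cos (q * y - c) = ε * Real.cos (q * y - c')) ∧
      ∀ y ∈ I, |q * y - c'| < Real.pi / 2 := by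
  obtain ⟨y₀, hy₀⟩ := hne
  set n : ℤ := round ((q * y₀ - c) / Real.pi) with hn
  have key : ∀ y, Real.cos (q * y - c) = (-1) ^ n * Real.cos (q * y - (c + n * Real.pi)) := by
    intro y
    rw [← Real.cos_add_int_mul_pi]
    congr 1
    ring
  have hε : ((-1 : ℝ) ^ n) ≠ 0 := zpow_ne_zero _ (by norm_num)
  have hne' : ∀ y ∈ I, |q * y - (c + n * Real.pi)| ≠ Real.pi / 2 := by
    intro y hy e
    apply h y hy
    rw [key, ← Real.cos_abs (q * y - _), e, Real.cos_pi_div_two, mul_zero]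
  have h0 : |q * y₀ - (c + n * Real.pi)| ≤ Real.pi / 2 := by
    have h1 := abs_sub_round ((q * y₀ - c) / Real.pi)
    have h2 : q * y₀ - (c + n * Real.pi) = ((q * y₀ - c) / Real.pi - n) * Real.pi := by
      field_simp
      ring
    rw [h2, abs_mul, abs_of_pos Real.pi_pos]
    nlinarith [Real.pi_pos]
  refine ⟨c + n * Real.pi, _, hε, key, fun y hy => ?_⟩
  by_contra! hlt
  have hcont : ContinuousOn (fun y => |q * y - (c + n * Real.pi)|) I := by fun_prop
  obtain ⟨z, hz, hz'⟩ := hc.isPreconnected.intermediate_value hy₀ hy hcont ⟨h0, hlt⟩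
  exact hne' z hz hz'

theorem deriv_inv_div_inv {g : ℝ → ℝ} {g' x : ℝ} (hg : HasDerivAt g g' x) (h0 : g x ≠ 0) :
    deriv (fun t => (g t)⁻¹) x / (g x)⁻¹ = -g' / g x := by
  rw [(hg.fun_inv h0).deriv]
  field_simp

theorem hasDerivAt_affine (a b x : ℝ) : HasDerivAt (fun t : ℝ => a * t + b) a x := by
  simpa using ((hasDerivAt_id x).const_mul a).add_const b

theorem deriv_logDeriv_inv_affine {I : Set ℝ} (hI : IsOpen I) {f : ℝ → ℝ} {a b : ℝ}
    (hf : ∀ x ∈ I, f x = (a * x + b)⁻¹) (hne : ∀ x ∈ I, f x ≠ 0) :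
    ∀ x ∈ I, deriv f x / f x = -a / (a * x + b) ∧
      deriv (fun t => deriv f t / f t) x = (deriv f x / f x) ^ 2 := by
  have h0 : ∀ x ∈ I, a * x + b ≠ 0 := fun x hx e => hne x hx (by rw [hf x hx, e, inv_zero])
  have h1 : ∀ x ∈ I, deriv f x / f x = -a / (a * x + b) := by
    intro x hx
    have e : f =ᶠ[𝓝 x] fun t => (a * t + b)⁻¹ := by
      filter_upwards [hI.mem_nhds hx] with t ht using hf t ht
    rw [e.deriv_eq, hf x hx]
    exact deriv_inv_div_inv (hasDerivAt_affine a b x) (h0 x hx)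
  intro x hx
  refine ⟨h1 x hx, ?_⟩
  have e : (fun t => deriv f t / f t) =ᶠ[𝓝 x] fun t => -a / (a * t + b) := by
    filter_upwards [hI.mem_nhds hx] with t ht using h1 t ht
  rw [e.deriv_eq, h1 x hx,
    ((hasDerivAt_const x (-a)).fun_div (hasDerivAt_affine a b x) (h0 x hx)).deriv]
  have := h0 x hx
  field_simp
  ring

/-- For `f₂ = 1/(q x + p)` and `f₃ = 1/(A(y) x + B(y))` the mixed equations of the flatness system
become ordinary differential equations for `A` and `B`. -/
theorem flatness_mixed_iff {I₁ I₂ : Set ℝ} (hI₁ : IsOpen I₁) (hI₂ : IsOpen I₂)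
    {f₂ : ℝ → ℝ} {f₃ : ℝ → ℝ → ℝ} (hf₂ne : ∀ x ∈ I₁, f₂ x ≠ 0)
    (hf₃ne : ∀ x ∈ I₁, ∀ y ∈ I₂, f₃ x y ≠ 0)
    {q p : ℝ} {A A' A'' B B' B'' : ℝ → ℝ}
    (hf₂ : ∀ x ∈ I₁, f₂ x = (q * x + p)⁻¹)
    (hf₃ : ∀ x ∈ I₁, ∀ y ∈ I₂, f₃ x y = (A y * x + B y)⁻¹)
    (hA : ∀ y ∈ I₂, HasDerivAt A (A' y) y) (hA' : ∀ y ∈ I₂, HasDerivAt A' (A'' y) y)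
    (hB : ∀ y ∈ I₂, HasDerivAt B (B' y) y) (hB' : ∀ y ∈ I₂, HasDerivAt B' (B'' y) y)
    {x y : ℝ} (hx : x ∈ I₁) (hy : y ∈ I₂) :
    (f₂ x * deriv (fun t => f₂ x * deriv (fun s => f₃ x s) t / f₃ x t) y
        - (f₂ x * deriv (fun t => f₃ x t) y / f₃ x y) ^ 2
        = deriv f₂ x / f₂ x * (deriv (fun t => f₃ t y) x / f₃ x y) ↔
      A'' y * x + B'' y = -(q * x + p) * q * A y) ∧
    (deriv (fun t => f₂ t * deriv (fun s => f₃ t s) y / f₃ t y) x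
        = deriv (fun t => f₃ t y) x / f₃ x y * (f₂ x * deriv (fun t => f₃ x t) y / f₃ x y) ↔
      A' y * (q * x + p) = (A' y * x + B' y) * q) := by
  have hu0 : ∀ x ∈ I₁, q * x + p ≠ 0 := fun x hx e =>
    hf₂ne x hx (by rw [hf₂ x hx, e, inv_zero])
  have hv0 : ∀ x ∈ I₁, ∀ y ∈ I₂, A y * x + B y ≠ 0 := fun x hx y hy e =>
    hf₃ne x hx y hy (by rw [hf₃ x hx y hy, e, inv_zero])
  have hvy : ∀ x, ∀ y ∈ I₂, HasDerivAt (fun s => A s * x + B s) (A' y * x + B' y) y :=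
    fun x y hy => ((hA y hy).mul_const x).fun_add (hB y hy)
  have hvyy : ∀ x, ∀ y ∈ I₂, HasDerivAt (fun s => A' s * x + B' s) (A'' y * x + B'' y) y :=
    fun x y hy => ((hA' y hy).mul_const x).fun_add (hB' y hy)
  have h32 : ∀ x ∈ I₁, ∀ y ∈ I₂, f₂ x * deriv (fun t => f₃ x t) y / f₃ x y
      = (q * x + p)⁻¹ * (-(A' y * x + B' y) / (A y * x + B y)) := by
    intro x hx y hy
    have e : (fun t => f₃ x t) =ᶠ[𝓝 y] fun t => (A t * x + B t)⁻¹ := by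
      filter_upwards [hI₂.mem_nhds hy] with t ht using hf₃ x hx t ht
    rw [mul_div_assoc, e.deriv_eq, hf₃ x hx y hy, hf₂ x hx,
      deriv_inv_div_inv (hvy x y hy) (hv0 x hx y hy)]
  have e1 : (fun t => f₂ x * deriv (fun s => f₃ x s) t / f₃ x t) =ᶠ[𝓝 y]
      fun t => (q * x + p)⁻¹ * (-(A' t * x + B' t) / (A t * x + B t)) := by
    filter_upwards [hI₂.mem_nhds hy] with t ht using h32 x hx t ht
  have e2 : (fun t => f₂ t * deriv (fun s => f₃ t s) y / f₃ t y) =ᶠ[𝓝 x]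
      fun t => (q * t + p)⁻¹ * (-(A' y * t + B' y) / (A y * t + B y)) := by
    filter_upwards [hI₁.mem_nhds hx] with t ht using h32 t ht y hy
  have hu := hu0 x hx
  have hv := hv0 x hx y hy
  rw [e1.deriv_eq, e2.deriv_eq, h32 x hx y hy,
    (deriv_logDeriv_inv_affine hI₁ hf₂ hf₂ne x hx).1,
    (deriv_logDeriv_inv_affine hI₁ (fun t ht => hf₃ t ht y hy) (fun t ht => hf₃ne t ht y hy)
      x hx).1, hf₂ x hx,
    (((hvyy x y hy).fun_neg.fun_div (hvy x y hy) hv).const_mul _).deriv,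
    (((hasDerivAt_affine q p x).fun_inv hu).fun_mul
      ((hasDerivAt_affine (A' y) (B' y) x).fun_neg.fun_div
        (hasDerivAt_affine (A y) (B y) x) hv)).deriv]
  constructor
  · rw [← sub_eq_zero, ← sub_eq_zero (a := A'' y * x + B'' y)]
    have : (q * x + p)⁻¹ * ((q * x + p)⁻¹ * ((-(A'' y * x + B'' y) * (A y * x + B y)
          - -(A' y * x + B' y) * (A' y * x + B' y)) / (A y * x + B y) ^ 2))
        - ((q * x + p)⁻¹ * (-(A' y * x + B' y) / (A y * x + B y))) ^ 2
        - -q / (q * x + p) * (-A y / (A y * x + B y))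
        = -(A'' y * x + B'' y - -(q * x + p) * q * A y)
          * ((q * x + p) ^ 2 * (A y * x + B y))⁻¹ := by
      generalize A y * x + B y = v at hv ⊢
      generalize q * x + p = u at hu ⊢
      field_simp
      ring
    rw [this]
    simp only [mul_eq_zero, inv_eq_zero, pow_eq_zero_iff, hu, hv, neg_eq_zero, ne_eq,
      OfNat.ofNat_ne_zero, not_false_eq_true, or_false]
  · rw [← sub_eq_zero, ← sub_eq_zero (a := A' y * (q * x + p))]
    have : -q / (q * x + p) ^ 2 * (-(A' y * x + B' y) / (A y * x + B y))
          + (q * x + p)⁻¹ * ((-A' y * (A y * x + B y) - -(A' y * x + B' y) * A y)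
            / (A y * x + B y) ^ 2)
        - -A y / (A y * x + B y) * ((q * x + p)⁻¹ * (-(A' y * x + B' y) / (A y * x + B y)))
        = -(A' y * (q * x + p) - (A' y * x + B' y) * q)
          * ((q * x + p) ^ 2 * (A y * x + B y))⁻¹ := by
      generalize A y * x + B y = v at hv ⊢
      generalize q * x + p = u at hu ⊢
      field_simp
      ring
    rw [this]
    simp only [mul_eq_zero, inv_eq_zero, pow_eq_zero_iff, hu, hv, neg_eq_zero, ne_eq,
      OfNat.ofNat_ne_zero, not_false_eq_true, or_false]


theorem exists_smooth_affine_coeffs {I₁ I₂ : Set ℝ} (hI₁ : IsOpen I₁) (hne : I₁.Nonempty)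
    {g : ℝ → ℝ → ℝ} (hg : ∀ x ∈ I₁, ContDiffOn ℝ (⊤ : ℕ∞) (g x) I₂)
    (h : ∀ y ∈ I₂, ∃ a b : ℝ, ∀ x ∈ I₁, g x y = a * x + b) :
    ∃ A B : ℝ → ℝ, ContDiffOn ℝ (⊤ : ℕ∞) A I₂ ∧ ContDiffOn ℝ (⊤ : ℕ∞) B I₂ ∧
      ∀ x ∈ I₁, ∀ y ∈ I₂, g x y = A y * x + B y := by
  obtain ⟨x₀, hx₀⟩ := hne
  obtain ⟨x₁, hx₁, hlt⟩ : ∃ x₁ ∈ I₁, x₁ ≠ x₀ := by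
    obtain ⟨ε, hε, hb⟩ := Metric.isOpen_iff.1 hI₁ x₀ hx₀
    refine ⟨x₀ + ε / 2, hb ?_, by linarith⟩
    rw [Metric.mem_ball, Real.dist_eq, add_sub_cancel_left, abs_of_pos (by linarith)]
    linarith
  have hA : ContDiffOn ℝ (⊤ : ℕ∞) (fun y => (g x₁ y - g x₀ y) / (x₁ - x₀)) I₂ :=
    ((hg x₁ hx₁).sub (hg x₀ hx₀)).div_const _
  refine ⟨_, fun y => g x₀ y - (g x₁ y - g x₀ y) / (x₁ - x₀) * x₀, hA,
    (hg x₀ hx₀).sub (hA.mul contDiffOn_const), fun x hx y hy => ?_⟩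
  obtain ⟨a, b, hab⟩ := h y hy
  have h10 := sub_ne_zero.2 hlt
  have : (g x₁ y - g x₀ y) / (x₁ - x₀) = a := by
    rw [hab x₁ hx₁, hab x₀ hx₀]
    field_simp
    ring
  dsimp only
  rw [this, hab x hx, hab x₀ hx₀]
  ring

/-- Sufficiency: solutions of the ordinary differential equations solve the flatness system. -/
theorem flatness_of_ode {I₁ I₂ : Set ℝ} (hI₁ : IsOpen I₁) (hI₂ : IsOpen I₂)
    {f₂ : ℝ → ℝ} {f₃ : ℝ → ℝ → ℝ} (hf₂ne : ∀ x ∈ I₁, f₂ x ≠ 0)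
    (hf₃ne : ∀ x ∈ I₁, ∀ y ∈ I₂, f₃ x y ≠ 0)
    (q p : ℝ) (A A' A'' B B' B'' : ℝ → ℝ)
    (hf₂ : ∀ x ∈ I₁, f₂ x = (q * x + p)⁻¹)
    (hf₃ : ∀ x ∈ I₁, ∀ y ∈ I₂, f₃ x y = (A y * x + B y)⁻¹)
    (hA : ∀ y, HasDerivAt A (A' y) y) (hA' : ∀ y, HasDerivAt A' (A'' y) y)
    (hB : ∀ y, HasDerivAt B (B' y) y) (hB' : ∀ y, HasDerivAt B' (B'' y) y)
    (h₂ : ∀ x y, A'' y * x + B'' y = -(q * x + p) * q * A y)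
    (h₃ : ∀ x y, A' y * (q * x + p) = (A' y * x + B' y) * q) :
    (∀ x ∈ I₁, deriv (fun x => deriv f₂ x / f₂ x) x = (deriv f₂ x / f₂ x) ^ 2) ∧
      ∀ x ∈ I₁, ∀ y ∈ I₂,
        deriv (fun t => deriv (fun t => f₃ t y) t / f₃ t y) x
          = (deriv (fun t => f₃ t y) x / f₃ x y) ^ 2 ∧
        f₂ x * deriv (fun t => f₂ x * deriv (fun s => f₃ x s) t / f₃ x t) y
          - (f₂ x * deriv (fun t => f₃ x t) y / f₃ x y) ^ 2
          = deriv f₂ x / f₂ x * (deriv (fun t => f₃ t y) x / f₃ x y) ∧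
        deriv (fun t => f₂ t * deriv (fun s => f₃ t s) y / f₃ t y) x
          = deriv (fun t => f₃ t y) x / f₃ x y
            * (f₂ x * deriv (fun t => f₃ x t) y / f₃ x y) := by
  refine ⟨fun x hx => (deriv_logDeriv_inv_affine hI₁ hf₂ hf₂ne x hx).2, fun x hx y hy => ?_⟩
  have h := flatness_mixed_iff hI₁ hI₂ hf₂ne hf₃ne hf₂ hf₃ (fun y _ => hA y) (fun y _ => hA' y)
    (fun y _ => hB y) (fun y _ => hB' y) hx hy
  exact ⟨(deriv_logDeriv_inv_affine hI₁ (fun t ht => hf₃ t ht y hy)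
    (fun t ht => hf₃ne t ht y hy) x hx).2, h.1.2 (h₂ x y), h.2.2 (h₃ x y)⟩

theorem hasDerivAt_const_mul_cos_div_sub (r k c y : ℝ) :
    HasDerivAt (fun y => r * Real.cos (y / k - c)) (-(r / k) * Real.sin (y / k - c)) y :=
  ((((hasDerivAt_id y).div_const k).sub_const c).cos.const_mul r).congr_deriv (by
    simp only [id]; ring)

theorem hasDerivAt_const_mul_sin_div_sub (r k c y : ℝ) :
    HasDerivAt (fun y => r * Real.sin (y / k - c)) (r / k * Real.cos (y / k - c)) y :=
  ((((hasDerivAt_id y).div_const k).sub_const c).sin.const_mul r).congr_deriv (by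
    simp only [id]; ring)


/-- Theorem 3.8 of the paper, in analytic form: for smooth nowhere-zero `f₂ : I₁ → ℝ` and
`f₃ : I₁ × I₂ → ℝ`, with `a₂₁ = f₂'/f₂`, `a₃₁ = ∂₁f₃/f₃`, `a₃₂ = f₂·∂₂f₃/f₃`, the flatness
system of the sequential warped product holds iff one of the seven listed cases holds. -/
theorem stmt_17 (I₁ I₂ : Set ℝ)
    (hI₁open : IsOpen I₁) (hI₁conn : I₁.OrdConnected) (hI₁ne : I₁.Nonempty)
    (hI₂open : IsOpen I₂) (hI₂conn : I₂.OrdConnected) (hI₂ne : I₂.Nonempty)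
    (f₂ : ℝ → ℝ) (f₃ : ℝ → ℝ → ℝ)
    (hf₂smooth : ContDiffOn ℝ (⊤ : ℕ∞) f₂ I₁) (hf₂ne : ∀ x ∈ I₁, f₂ x ≠ 0)
    (hf₃smooth : ContDiffOn ℝ (⊤ : ℕ∞) (Function.uncurry f₃) (I₁ ×ˢ I₂))
    (hf₃ne : ∀ x ∈ I₁, ∀ y ∈ I₂, f₃ x y ≠ 0)
    (a₂₁ : ℝ → ℝ) (ha₂₁ : a₂₁ = fun x => deriv f₂ x / f₂ x)
    (a₃₁ a₃₂ : ℝ → ℝ → ℝ)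
    (ha₃₁ : a₃₁ = fun x y => deriv (fun t => f₃ t y) x / f₃ x y)
    (ha₃₂ : a₃₂ = fun x y => f₂ x * deriv (fun t => f₃ x t) y / f₃ x y) :
    ((∀ x ∈ I₁, deriv a₂₁ x = (a₂₁ x) ^ 2) ∧
      (∀ x ∈ I₁, ∀ y ∈ I₂,
        deriv (fun t => a₃₁ t y) x = (a₃₁ x y) ^ 2 ∧
        f₂ x * deriv (fun t => a₃₂ x t) y - (a₃₂ x y) ^ 2 = a₂₁ x * a₃₁ x y ∧
        deriv (fun t => a₃₂ t y) x = a₃₁ x y * a₃₂ x y)) ↔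
      -- (1) both constant
      ((∃ k₂ : ℝ, k₂ ≠ 0 ∧ ∀ x ∈ I₁, f₂ x = k₂) ∧
        (∃ k₃ : ℝ, k₃ ≠ 0 ∧ ∀ x ∈ I₁, ∀ y ∈ I₂, f₃ x y = k₃)) ∨
      -- (2) f₂ constant, f₃ = k₃/(x¹ - c₃)
      ((∃ k₂ : ℝ, k₂ ≠ 0 ∧ ∀ x ∈ I₁, f₂ x = k₂) ∧
        ∃ k₃ : ℝ, k₃ ≠ 0 ∧ ∃ c₃ : ℝ, c₃ ∉ I₁ ∧
          ∀ x ∈ I₁, ∀ y ∈ I₂, f₃ x y = k₃ / (x - c₃)) ∨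
      -- (3) f₂ constant, f₃ = k₃/(x² - c₃)
      ((∃ k₂ : ℝ, k₂ ≠ 0 ∧ ∀ x ∈ I₁, f₂ x = k₂) ∧
        ∃ k₃ : ℝ, k₃ ≠ 0 ∧ ∃ c₃ : ℝ, c₃ ∉ I₂ ∧
          ∀ x ∈ I₁, ∀ y ∈ I₂, f₃ x y = k₃ / (y - c₃)) ∨
      -- (4) f₂ constant, f₃ = k₃/(c₁x¹ + x² + c₂)
      ((∃ k₂ : ℝ, k₂ ≠ 0 ∧ ∀ x ∈ I₁, f₂ x = k₂) ∧
        ∃ k₃ : ℝ, k₃ ≠ 0 ∧ ∃ c₁ : ℝ, c₁ ≠ 0 ∧ ∃ c₂ : ℝ,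
          (∀ x ∈ I₁, ∀ y ∈ I₂, c₁ * x + y + c₂ ≠ 0) ∧
          ∀ x ∈ I₁, ∀ y ∈ I₂, f₃ x y = k₃ / (c₁ * x + y + c₂)) ∨
      -- (5) f₂ = k₂/(x¹ - c₂), f₃ constant
      ((∃ k₂ : ℝ, k₂ ≠ 0 ∧ ∃ c₂ : ℝ, c₂ ∉ I₁ ∧
          ∀ x ∈ I₁, f₂ x = k₂ / (x - c₂)) ∧
        ∃ k₃ : ℝ, k₃ ≠ 0 ∧ ∀ x ∈ I₁, ∀ y ∈ I₂, f₃ x y = k₃) ∨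
      -- (6) f₂ = k₂/(x¹ - c₂), f₃ = k₃/((x¹ - c₂)cos(x²/k₂ - c₃))
      (∃ k₂ : ℝ, k₂ ≠ 0 ∧ ∃ c₂ : ℝ, c₂ ∉ I₁ ∧
        (∀ x ∈ I₁, f₂ x = k₂ / (x - c₂)) ∧
        ∃ k₃ : ℝ, k₃ ≠ 0 ∧ ∃ c₃ : ℝ,
          (∀ y ∈ I₂, |y / k₂ - c₃| < Real.pi / 2) ∧
          ∀ x ∈ I₁, ∀ y ∈ I₂,
            f₃ x y = k₃ / ((x - c₂) * Real.cos (y / k₂ - c₃))) ∨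
      -- (7) f₂ = k₂/(x¹ - c₂), f₃ = k₃/(1 + c₁(x¹ - c₂)cos(x²/k₂ - c₃))
      (∃ c₁ : ℝ, c₁ ≠ 0 ∧ ∃ k₂ : ℝ, k₂ ≠ 0 ∧ ∃ c₂ : ℝ, c₂ ∉ I₁ ∧
        (∀ x ∈ I₁, f₂ x = k₂ / (x - c₂)) ∧
        ∃ k₃ : ℝ, k₃ ≠ 0 ∧ ∃ c₃ : ℝ,
          (∀ x ∈ I₁, ∀ y ∈ I₂,
            1 + c₁ * (x - c₂) * Real.cos (y / k₂ - c₃) ≠ 0) ∧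
          ∀ x ∈ I₁, ∀ y ∈ I₂,
            f₃ x y = k₃ / (1 + c₁ * (x - c₂) * Real.cos (y / k₂ - c₃))) := by
  subst ha₂₁ ha₃₁ ha₃₂
  constructor
  · rintro ⟨hS₂, hS₃⟩
    obtain ⟨q, p, hu⟩ := exists_inv_eq_affine hI₁open hI₁conn hf₂smooth hf₂ne hS₂
    have hf₂ : ∀ x ∈ I₁, f₂ x = (q * x + p)⁻¹ := fun x hx => by rw [← hu x hx, inv_inv]
    have hu0 : ∀ x ∈ I₁, q * x + p ≠ 0 := fun x hx => by
      rw [← hu x hx]; exact inv_ne_zero (hf₂ne x hx)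
    have hsec₁ : ∀ y ∈ I₂, ContDiffOn ℝ (⊤ : ℕ∞) (fun x => f₃ x y) I₁ := fun y hy =>
      hf₃smooth.comp (f := fun x : ℝ => (x, y)) (by fun_prop) fun x hx => ⟨hx, hy⟩
    have hsec₂ : ∀ x ∈ I₁, ContDiffOn ℝ (⊤ : ℕ∞) (fun y => f₃ x y) I₂ := fun x hx =>
      hf₃smooth.comp (f := fun y : ℝ => (x, y)) (by fun_prop) fun y hy => ⟨hx, hy⟩
    obtain ⟨A, B, hAs, hBs, hv⟩ := exists_smooth_affine_coeffs (g := fun x y => (f₃ x y)⁻¹)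
      hI₁open hI₁ne (fun x hx => (hsec₂ x hx).inv fun y hy => hf₃ne x hx y hy)
      (fun y hy => exists_inv_eq_affine hI₁open hI₁conn (hsec₁ y hy)
        (fun x hx => hf₃ne x hx y hy) fun x hx => (hS₃ x hx y hy).1)
    have hf₃ : ∀ x ∈ I₁, ∀ y ∈ I₂, f₃ x y = (A y * x + B y)⁻¹ := fun x hx y hy => by
      rw [← hv x hx y hy, inv_inv]
    have hv0 : ∀ x ∈ I₁, ∀ y ∈ I₂, A y * x + B y ≠ 0 := fun x hx y hy => by
      rw [← hv x hx y hy]; exact inv_ne_zero (hf₃ne x hx y hy)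
    have hA : ∀ y ∈ I₂, HasDerivAt A (deriv A y) y := fun y hy =>
      hAs.hasDerivAt_of_isOpen hI₂open hy
    have hB : ∀ y ∈ I₂, HasDerivAt B (deriv B y) y := fun y hy =>
      hBs.hasDerivAt_of_isOpen hI₂open hy
    have hA' : ∀ y ∈ I₂, HasDerivAt (deriv A) (deriv (deriv A) y) y := fun y hy =>
      (hAs.deriv_of_isOpen_top hI₂open).hasDerivAt_of_isOpen hI₂open hy
    have hB' : ∀ y ∈ I₂, HasDerivAt (deriv B) (deriv (deriv B) y) y := fun y hy =>
      (hBs.deriv_of_isOpen_top hI₂open).hasDerivAt_of_isOpen hI₂open hy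
    have hode := fun x hx y hy => flatness_mixed_iff hI₁open hI₂open hf₂ne hf₃ne hf₂ hf₃
      hA hA' hB hB' (x := x) (y := y) hx hy
    have h₂ := fun x hx y hy => (hode x hx y hy).1.1 (hS₃ x hx y hy).2.1
    have h₃ := fun x hx y hy => (hode x hx y hy).2.1 (hS₃ x hx y hy).2.2
    obtain ⟨x₀, hx₀⟩ := hI₁ne
    obtain ⟨y₀, hy₀⟩ := id hI₂ne
    by_cases hq : q = 0
    · subst hq
      have hp : p ≠ 0 := by simpa using hu0 x₀ hx₀
      have hconst : ∃ k₂ : ℝ, k₂ ≠ 0 ∧ ∀ x ∈ I₁, f₂ x = k₂ :=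
        ⟨p⁻¹, inv_ne_zero hp, fun x hx => by rw [hf₂ x hx, zero_mul, zero_add]⟩
      have hAz : ∀ y ∈ I₂, deriv A y = 0 := fun y hy => by
        simpa [hp] using h₃ x₀ hx₀ y hy
      obtain ⟨a, ha⟩ := exists_eq_const_of_hasDerivAt_zero hI₂open hI₂conn (f := A)
        fun y hy => by rw [← hAz y hy]; exact hA y hy
      have hAzz : ∀ y ∈ I₂, deriv (deriv A) y = 0 := fun y hy => by
        have e : deriv A =ᶠ[𝓝 y] fun _ => 0 := by
          filter_upwards [hI₂open.mem_nhds hy] with t ht using hAz t ht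
        rw [e.deriv_eq, deriv_const]
      have hBzz : ∀ y ∈ I₂, deriv (deriv B) y = 0 := fun y hy => by
        simpa [hAzz y hy] using h₂ x₀ hx₀ y hy
      obtain ⟨b, hb⟩ := exists_eq_const_of_hasDerivAt_zero hI₂open hI₂conn (f := deriv B)
        fun y hy => by rw [← hBzz y hy]; exact hB' y hy
      obtain ⟨c, hc⟩ := exists_eq_affine_of_hasDerivAt_const hI₂open hI₂conn (f := B) (a := b)
        fun y hy => by rw [← hb y hy]; exact hB y hy
      have hf : ∀ x ∈ I₁, ∀ y ∈ I₂, f₃ x y = (a * x + (b * y + c))⁻¹ := fun x hx y hy => by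
        rw [hf₃ x hx y hy, ha y hy, hc y hy]
      have h0 : ∀ x ∈ I₁, ∀ y ∈ I₂, a * x + (b * y + c) ≠ 0 := fun x hx y hy => by
        rw [← ha y hy, ← hc y hy]; exact hv0 x hx y hy
      by_cases ha0 : a = 0
      · subst ha0
        by_cases hb0 : b = 0
        · subst hb0
          left
          have hc0 : c ≠ 0 := by simpa using h0 x₀ hx₀ y₀ hy₀
          exact ⟨hconst, c⁻¹, inv_ne_zero hc0, fun x hx y hy => by simp [hf x hx y hy]⟩
        · right; right; left
          have e : ∀ y, 0 * x₀ + (b * y + c) = b * (y - -(c / b)) := fun y => by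
            field_simp
            ring
          refine ⟨hconst, b⁻¹, inv_ne_zero hb0, -(c / b), fun hmem => ?_, fun x hx y hy => ?_⟩
          · exact h0 x₀ hx₀ _ hmem (by rw [e, sub_self, mul_zero])
          · rw [hf x hx y hy, zero_mul, ← zero_mul x₀, e, mul_inv, ← div_eq_mul_inv]
      · by_cases hb0 : b = 0
        · subst hb0
          right; left
          have e : ∀ x, a * x + (0 * y₀ + c) = a * (x - -(c / a)) := fun x => by
            field_simp
            ring
          refine ⟨hconst, a⁻¹, inv_ne_zero ha0, -(c / a), fun hmem => ?_, fun x hx y hy => ?_⟩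
          · exact h0 _ hmem y₀ hy₀ (by rw [e, sub_self, mul_zero])
          · rw [hf x hx y hy, zero_mul, ← zero_mul y₀, e, mul_inv, ← div_eq_mul_inv]
        · right; right; right; left
          have e : ∀ x y, a * x + (b * y + c) = b * (a / b * x + y + c / b) := fun x y => by
            field_simp
            ring
          refine ⟨hconst, b⁻¹, inv_ne_zero hb0, a / b, div_ne_zero ha0 hb0, c / b,
            fun x hx y hy => ?_, fun x hx y hy => ?_⟩
          · have := h0 x hx y hy
            rw [e] at this
            exact right_ne_zero_of_mul this
          · rw [hf x hx y hy, e, mul_inv, ← div_eq_mul_inv]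
    · have hpB : ∀ y ∈ I₂, deriv B y = deriv A y * (p / q) := fun y hy => by
        have := h₃ x₀ hx₀ y hy
        field_simp
        linear_combination -this
      obtain ⟨D, hD⟩ := exists_eq_const_of_hasDerivAt_zero hI₂open hI₂conn
        (f := fun y => B y - A y * (p / q)) fun y hy =>
          ((hB y hy).fun_sub ((hA y hy).mul_const (p / q))).congr_deriv (by rw [hpB y hy, sub_self])
      have hBB : ∀ y ∈ I₂, deriv (deriv B) y = deriv (deriv A) y * (p / q) := fun y hy => by
        have e : deriv B =ᶠ[𝓝 y] fun y => deriv A y * (p / q) := by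
          filter_upwards [hI₂open.mem_nhds hy] with t ht using hpB t ht
        rw [e.deriv_eq, ((hA' y hy).mul_const (p / q)).deriv]
      have hAA : ∀ y ∈ I₂, deriv (deriv A) y = -q ^ 2 * A y := fun y hy => by
        have := h₂ x₀ hx₀ y hy
        rw [hBB y hy] at this
        apply mul_left_cancel₀ (hu0 x₀ hx₀)
        field_simp at this
        linear_combination this
      obtain ⟨R, c, hR⟩ := exists_eq_mul_cos_of_oscillator hI₂open hI₂conn hq hA
        fun y hy => by rw [← hAA y hy]; exact hA' y hy
      have hk : q⁻¹ ≠ 0 := inv_ne_zero hq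
      have hlin : ∀ x, q * x + p = q * (x - -(p / q)) := fun x => by
        field_simp
        ring
      have hmem : -(p / q) ∉ I₁ := fun hmem =>
        hu0 _ hmem (by rw [hlin, sub_self, mul_zero])
      have hf₂' : ∀ x ∈ I₁, f₂ x = q⁻¹ / (x - -(p / q)) := fun x hx => by
        rw [hf₂ x hx, hlin, mul_inv, ← div_eq_mul_inv]
      have hdiv : ∀ y, y / q⁻¹ = q * y := fun y => by rw [div_inv_eq_mul, mul_comm]
      have hV : ∀ x, ∀ y ∈ I₂,
          A y * x + B y = R * (x - -(p / q)) * Real.cos (q * y - c) + D := fun x y hy => by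
        rw [← hD y hy, mul_right_comm, ← hR y hy]
        ring
      by_cases hR0 : R = 0
      · subst hR0
        right; right; right; right; left
        have hD0 : D ≠ 0 := by
          have := hv0 x₀ hx₀ y₀ hy₀
          rw [hV x₀ y₀ hy₀] at this
          simpa using this
        exact ⟨⟨q⁻¹, hk, -(p / q), hmem, hf₂'⟩, D⁻¹, inv_ne_zero hD0, fun x hx y hy => by
          rw [hf₃ x hx y hy, hV x y hy]; simp⟩
      · by_cases hD0 : D = 0
        · subst hD0
          right; right; right; right; right; left
          obtain ⟨c', ε, hε, hcos, hlt⟩ := exists_phase_abs_lt (q := q) (c := c) hI₂conn hI₂ne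
            fun y hy e => hv0 x₀ hx₀ y hy (by rw [hV x₀ y hy, e, mul_zero, add_zero])
          refine ⟨q⁻¹, hk, -(p / q), hmem, hf₂', (R * ε)⁻¹, inv_ne_zero (mul_ne_zero hR0 hε), c',
            fun y hy => by rw [hdiv]; exact hlt y hy, fun x hx y hy => ?_⟩
          rw [hf₃ x hx y hy, hV x y hy, hcos, hdiv, inv_div_left]
          congr 1
          ring
        · right; right; right; right; right; right
          have e : ∀ x, ∀ y ∈ I₂, A y * x + B y
              = D * (1 + R / D * (x - -(p / q)) * Real.cos (y / q⁻¹ - c)) := fun x y hy => by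
            rw [hV x y hy, hdiv, mul_add, mul_one, add_comm, ← mul_assoc, ← mul_assoc,
              mul_div_cancel₀ _ hD0]
          refine ⟨R / D, div_ne_zero hR0 hD0, q⁻¹, hk, -(p / q), hmem, hf₂', D⁻¹,
            inv_ne_zero hD0, c, fun x hx y hy => ?_, fun x hx y hy => ?_⟩
          · have := hv0 x hx y hy
            rw [e x y hy] at this
            exact right_ne_zero_of_mul this
          · rw [hf₃ x hx y hy, e x y hy, mul_inv, ← div_eq_mul_inv]
  · have hz : ∀ a y : ℝ, HasDerivAt (fun _ : ℝ => a) 0 y := fun a y => hasDerivAt_const y a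
    have hc2 : ∀ k c x : ℝ, k / (x - c) = (k⁻¹ * x + -(k⁻¹ * c))⁻¹ := fun k c x => by
      rw [← sub_eq_add_neg, ← mul_sub, mul_inv, inv_inv, div_eq_mul_inv]
    have main := flatness_of_ode hI₁open hI₂open hf₂ne hf₃ne
    rintro (⟨⟨k₂, -, h2⟩, k₃, -, h3⟩ | ⟨⟨k₂, -, h2⟩, k₃, -, c₃, -, h3⟩ |
      ⟨⟨k₂, -, h2⟩, k₃, -, c₃, -, h3⟩ | ⟨⟨k₂, -, h2⟩, k₃, -, c₁, -, c₂, -, h3⟩ |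
      ⟨⟨k₂, -, c₂, -, h2⟩, k₃, -, h3⟩ | ⟨k₂, -, c₂, -, h2, k₃, -, c₃, -, h3⟩ |
      ⟨c₁, -, k₂, -, c₂, -, h2, k₃, -, c₃, -, h3⟩)
    · exact main 0 k₂⁻¹ _ _ _ _ _ _ (fun x hx => by simp [h2 x hx])
        (fun x hx y hy => by rw [h3 x hx y hy, zero_mul, zero_add, inv_inv])
        (hz 0) (hz 0) (hz k₃⁻¹) (hz 0) (fun x y => by ring) (fun x y => by ring)
    · exact main 0 k₂⁻¹ _ _ _ _ _ _ (fun x hx => by simp [h2 x hx])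
        (fun x hx y hy => by rw [h3 x hx y hy, hc2])
        (hz k₃⁻¹) (hz 0) (hz (-(k₃⁻¹ * c₃))) (hz 0) (fun x y => by ring) (fun x y => by ring)
    · exact main 0 k₂⁻¹ _ _ _ _ _ _ (fun x hx => by simp [h2 x hx])
        (fun x hx y hy => by rw [h3 x hx y hy, hc2, zero_mul, zero_add])
        (hz 0) (hz 0) (hasDerivAt_affine k₃⁻¹ (-(k₃⁻¹ * c₃))) (hz _)
        (fun x y => by ring) (fun x y => by ring)
    · exact main 0 k₂⁻¹ _ _ _ _ _ _ (fun x hx => by simp [h2 x hx])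
        (fun x hx y hy => by
          rw [h3 x hx y hy, ← inv_div, div_eq_inv_mul]
          congr 1
          ring)
        (hz (k₃⁻¹ * c₁)) (hz 0) (hasDerivAt_affine k₃⁻¹ (k₃⁻¹ * c₂)) (hz _)
        (fun x y => by ring) (fun x y => by ring)
    · exact main k₂⁻¹ (-(k₂⁻¹ * c₂)) _ _ _ _ _ _ (fun x hx => by rw [h2 x hx, hc2])
        (fun x hx y hy => by rw [h3 x hx y hy, zero_mul, zero_add, inv_inv])
        (hz 0) (hz 0) (hz k₃⁻¹) (hz 0) (fun x y => by ring) (fun x y => by ring)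
    · exact main k₂⁻¹ (-(k₂⁻¹ * c₂)) _ _ _ _ _ _ (fun x hx => by rw [h2 x hx, hc2])
        (fun x hx y hy => by
          rw [h3 x hx y hy, ← inv_div, div_eq_inv_mul]
          congr 1
          ring)
        (hasDerivAt_const_mul_cos_div_sub k₃⁻¹ k₂ c₃) (hasDerivAt_const_mul_sin_div_sub _ k₂ c₃)
        (hasDerivAt_const_mul_cos_div_sub (-(k₃⁻¹ * c₂)) k₂ c₃)
        (hasDerivAt_const_mul_sin_div_sub _ k₂ c₃) (fun x y => by ring) (fun x y => by ring)
    · exact main k₂⁻¹ (-(k₂⁻¹ * c₂)) _ _ _ _ _ _ (fun x hx => by rw [h2 x hx, hc2])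
        (fun x hx y hy => by
          rw [h3 x hx y hy, ← inv_div, div_eq_inv_mul]
          congr 1
          ring)
        (hasDerivAt_const_mul_cos_div_sub (k₃⁻¹ * c₁) k₂ c₃)
        (hasDerivAt_const_mul_sin_div_sub _ k₂ c₃)
        (fun y => (hasDerivAt_const_mul_cos_div_sub (-(k₃⁻¹ * c₁ * c₂)) k₂ c₃ y).add_const k₃⁻¹)
        (hasDerivAt_const_mul_sin_div_sub _ k₂ c₃) (fun x y => by ring) (fun x y => by ring)
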